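/- Let G be a connected graph on n ≥ 3 vertices and |G⟩ the corresponding graph state with stabilizer S; let S_d be the subgroup of S generated by all elements of S of weight at most d, and let η(|G⟩) be the minimal d such that S_d = S. If d < η(|G⟩) and H' is a d-body Hamiltonian on n qubits having |G⟩ as a ground state, then the ground state of H' is degenerate (the smallest eigenvalue of H' has multiplicity at least 2). Equivalently, any n-qubit Hamiltonian having |G⟩ as a non-degenerate ground state must involve at least η(|G⟩)-body interactions. -/

import Mathlib

open Matrix BigOperators
open scoped Classical

noncomputable section

/-- The state space of `n` qubits, `(ℂ²)^{⊗n}`, realized as functions from bit strings to `ℂ`. -/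
abbrev QState (n : ℕ) : Type := (Fin n → Fin 2) → ℂ

/-- Operators on `n` qubits. -/
abbrev QOp (n : ℕ) : Type := Matrix (Fin n → Fin 2) (Fin n → Fin 2) ℂ

/-- The single qubit Pauli matrices: `0 ↦ σ₀ = I`, `1 ↦ σ_x`, `2 ↦ σ_y`, `3 ↦ σ_z`. -/
def pauli1 (k : Fin 4) : Matrix (Fin 2) (Fin 2) ℂ :=
  if k = 0 then 1
  else if k = 1 then !![0, 1; 1, 0]
  else if k = 2 then !![0, -Complex.I; Complex.I, 0]
  else !![1, 0; 0, -1]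

/-- The `n`-qubit Pauli operator `σ_{f 0} ⊗ σ_{f 1} ⊗ ⋯ ⊗ σ_{f (n-1)}`. -/
def pauliOp {n : ℕ} (f : Fin n → Fin 4) : QOp n :=
  Matrix.of fun v w => ∏ i, pauli1 (f i) (v i) (w i)

/-- The support of a Pauli operator: the qubits on which it acts nontrivially. -/
def pSupport {n : ℕ} (f : Fin n → Fin 4) : Finset (Fin n) :=
  Finset.univ.filter fun i => f i ≠ 0

/-- The weight of a Pauli operator: the number of qubits on which it acts nontrivially. -/
def pWeight {n : ℕ} (f : Fin n → Fin 4) : ℕ := (pSupport f).card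

/-- `g` is the signed Pauli operator `±σ_f`. -/
def IsSignedPauli {n : ℕ} (g : QOp n) (f : Fin n → Fin 4) : Prop :=
  g = pauliOp f ∨ g = -pauliOp f

/-- The squared norm `∑_v |ψ_v|²` of an `n`-qubit state. -/
def qNormSq {n : ℕ} (ψ : QState n) : ℝ := ∑ v, Complex.normSq (ψ v)

/-- The inner product `⟨φ|ψ⟩` (antilinear in the first argument). -/
def qInner {n : ℕ} (φ ψ : QState n) : ℂ := ∑ v, starRingEnd ℂ (φ v) * ψ v

/-- The graph state correlation operator `K_a = σ_x^(a) ∏_{b ∈ N(a)} σ_z^(b)`. -/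
def Kop {n : ℕ} (G : SimpleGraph (Fin n)) [DecidableRel G.Adj] (a : Fin n) : QOp n :=
  pauliOp fun b => if b = a then 1 else if G.Adj a b then 3 else 0

/-- `ψ` is the graph state `|G⟩`: a unit vector fixed by all correlation operators `K_a`. -/
def IsGraphState {n : ℕ} (G : SimpleGraph (Fin n)) [DecidableRel G.Adj] (ψ : QState n) : Prop :=
  qNormSq ψ = 1 ∧ ∀ a : Fin n, Kop G a *ᵥ ψ = ψ

/-- The stabilizer of `ψ`: all signed Pauli operators `g = ±σ` with `g ψ = ψ`. -/
def stab {n : ℕ} (ψ : QState n) : Set (QOp n) :=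
  {g | (∃ f, IsSignedPauli g f) ∧ g *ᵥ ψ = ψ}

/-- The stabilizer elements of weight at most `d`. -/
def stabW {n : ℕ} (ψ : QState n) (d : ℕ) : Set (QOp n) :=
  {g | g ∈ stab ψ ∧ ∃ f, IsSignedPauli g f ∧ pWeight f ≤ d}

/-- `S_d`: the subgroup of the stabilizer generated by all elements of weight at most `d`,
as a set of operators.  (Since the stabilizer is a finite group, the generated submonoid
coincides with the generated subgroup.) -/
def SdSet {n : ℕ} (ψ : QState n) (d : ℕ) : Set (QOp n) :=
  (Submonoid.closure (stabW ψ d) : Set (QOp n))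

/-- `δ(|ψ⟩)`: the minimal weight of a nonidentity element of the stabilizer of `ψ`. -/
def deltaG {n : ℕ} (ψ : QState n) : ℕ :=
  sInf {d | ∃ g ∈ stab ψ, g ≠ 1 ∧ ∃ f, IsSignedPauli g f ∧ pWeight f = d}

/-- `η(|ψ⟩)`: the minimal `d` such that `S_d = S`. -/
def etaG {n : ℕ} (ψ : QState n) : ℕ :=
  sInf {d | stab ψ ⊆ SdSet ψ d}

/-- A `d`-body Hamiltonian on `n` qubits: a real linear combination of Pauli operators
of weight at most `d`. -/
def IsDBody {n : ℕ} (d : ℕ) (H : QOp n) : Prop :=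
  ∃ h : (Fin n → Fin 4) → ℝ, (∀ f, d < pWeight f → h f = 0) ∧
    H = ∑ f : Fin n → Fin 4, (h f : ℂ) • pauliOp f

/-- A Hamiltonian is nontrivial if it is nonzero and not a multiple of the identity. -/
def NontrivialHam {n : ℕ} (H : QOp n) : Prop :=
  H ≠ 0 ∧ ∀ c : ℂ, H ≠ c • (1 : QOp n)

/-- `φ` is an eigenvector of `H` with (real) eigenvalue `E`. -/
def IsEigenpair {n : ℕ} (H : QOp n) (E : ℝ) (φ : QState n) : Prop :=
  φ ≠ 0 ∧ H *ᵥ φ = (E : ℂ) • φ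

/-- `ψ` is a ground state of `H` with ground energy `E`: an eigenvector for the smallest
eigenvalue `E` of `H`. -/
def IsGroundStateE {n : ℕ} (H : QOp n) (ψ : QState n) (E : ℝ) : Prop :=
  IsEigenpair H E ψ ∧ ∀ E' φ, IsEigenpair H E' φ → E ≤ E'

/-- `ψ` is a ground state of `H`. -/
def IsGroundState {n : ℕ} (H : QOp n) (ψ : QState n) : Prop :=
  ∃ E, IsGroundStateE H ψ E

/-- The dimension of the eigenspace of `H` for the eigenvalue `E` (the multiplicity of `E`). -/
def eigDim {n : ℕ} (H : QOp n) (E : ℝ) : ℕ :=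
  Module.finrank ℂ (Module.End.eigenspace (Matrix.mulVecLin H) ((E : ℂ)))


/-- The tensor product of a family of one-qubit operators. -/
def tensorOp {n : ℕ} (A : Fin n → Matrix (Fin 2) (Fin 2) ℂ) : QOp n :=
  Matrix.of fun v w => ∏ i, A i (v i) (w i)

lemma tensorOp_mul {n : ℕ} (A B : Fin n → Matrix (Fin 2) (Fin 2) ℂ) :
    tensorOp A * tensorOp B = tensorOp fun i => A i * B i := by
  ext v w
  simp only [tensorOp, Matrix.mul_apply, Matrix.of_apply, ← Finset.prod_mul_distrib]
  rw [Finset.prod_univ_sum, Fintype.piFinset_univ]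

lemma tensorOp_smul {n : ℕ} (c : Fin n → ℂ) (A : Fin n → Matrix (Fin 2) (Fin 2) ℂ) :
    tensorOp (fun i => c i • A i) = (∏ i, c i) • tensorOp A := by
  ext v w
  simp [tensorOp, Finset.prod_mul_distrib]

lemma tensorOp_one {n : ℕ} :
    tensorOp (fun _ : Fin n => (1 : Matrix (Fin 2) (Fin 2) ℂ)) = 1 := by
  ext v w
  simp only [tensorOp, Matrix.of_apply, Matrix.one_apply]
  by_cases h : v = w
  · simp [h]
  · obtain ⟨i, hi⟩ := Function.ne_iff.mp h
    rw [if_neg h]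
    exact Finset.prod_eq_zero (Finset.mem_univ i) (if_neg hi)

lemma pauliOp_eq_tensorOp {n : ℕ} (f : Fin n → Fin 4) :
    pauliOp f = tensorOp fun i => pauli1 (f i) := rfl

/-- Up to a phase, the Pauli labels multiply by bitwise exclusive or. -/
lemma exists_pauli1_mul (j k : Fin 4) :
    ∃ c : ℂ, c ≠ 0 ∧ pauli1 j * pauli1 k = c • pauli1 (j ^^^ k) := by
  fin_cases j <;> fin_cases k
  all_goals first
    | refine ⟨1, by simp, ?_⟩; simp [pauli1, Matrix.one_fin_two]; done
    | refine ⟨Complex.I, by simp, ?_⟩; simp [pauli1]; done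
    | refine ⟨-Complex.I, by simp, ?_⟩; simp [pauli1]

lemma exists_pauliOp_mul {n : ℕ} (f g : Fin n → Fin 4) :
    ∃ c : ℂ, c ≠ 0 ∧ pauliOp f * pauliOp g = c • pauliOp fun i => f i ^^^ g i := by
  choose c hc hmul using exists_pauli1_mul
  refine ⟨∏ i, c (f i) (g i), Finset.prod_ne_zero_iff.mpr fun i _ => hc _ _, ?_⟩
  simp only [pauliOp_eq_tensorOp, tensorOp_mul, hmul]
  exact tensorOp_smul _ _

lemma pauliOp_zero {n : ℕ} : pauliOp (0 : Fin n → Fin 4) = 1 := by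
  rw [pauliOp_eq_tensorOp, ← tensorOp_one]
  simp [pauli1]

lemma pauliOp_mul_self {n : ℕ} (f : Fin n → Fin 4) : pauliOp f * pauliOp f = 1 := by
  have h (k : Fin 4) : pauli1 k * pauli1 k = 1 := by
    fin_cases k <;> simp [pauli1, Matrix.one_fin_two]
  simp only [pauliOp_eq_tensorOp, tensorOp_mul, h, tensorOp_one]

lemma pauliOp_isHermitian {n : ℕ} (f : Fin n → Fin 4) : (pauliOp f).IsHermitian := by
  have h (k : Fin 4) (a b : Fin 2) : star (pauli1 k b a) = pauli1 k a b := by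
    fin_cases k <;> fin_cases a <;> fin_cases b <;> simp [pauli1]
  ext v w
  simp only [Matrix.conjTranspose_apply, pauliOp, Matrix.of_apply, star_prod, h]

/-- The bit-flip part of a Pauli operator: the sites carrying `σ_x` or `σ_y`. -/
def xPart {n : ℕ} (f : Fin n → Fin 4) : Fin n → ZMod 2 :=
  fun i => if f i = 1 ∨ f i = 2 then 1 else 0

lemma xPart_xor {n : ℕ} (f g : Fin n → Fin 4) :
    xPart (fun i => f i ^^^ g i) = xPart f + xPart g := by
  have h (j k : Fin 4) : (if j ^^^ k = 1 ∨ j ^^^ k = 2 then 1 else 0 : ZMod 2) =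
      (if j = 1 ∨ j = 2 then 1 else 0) + if k = 1 ∨ k = 2 then 1 else 0 := by
    revert j k; decide
  ext i
  simpa [xPart] using h (f i) (g i)

/-- The label of the product of `σ_z` over the sites where `z` is nonzero. -/
def zLabel {n : ℕ} (z : Fin n → ZMod 2) : Fin n → Fin 4 :=
  fun i => if z i = 0 then 0 else 3

/-- The nontrivial sign character of `ZMod 2`. -/
def sgn2 (a : ZMod 2) : ℂ := if a = 0 then 1 else -1

lemma sgn2_add (a b : ZMod 2) : sgn2 (a + b) = sgn2 a * sgn2 b := by
  have h (a : ZMod 2) : a = 0 ∨ a = 1 := by revert a; decide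
  have h2 : (1 + 1 : ZMod 2) = 0 := by decide
  rcases h a with rfl | rfl <;> rcases h b with rfl | rfl <;> simp [sgn2, h2]

lemma sgn2_sum {ι : Type*} (s : Finset ι) (a : ι → ZMod 2) :
    sgn2 (∑ i ∈ s, a i) = ∏ i ∈ s, sgn2 (a i) := by
  induction s using Finset.induction_on with
  | empty => simp [sgn2]
  | insert i s hi ih => rw [Finset.sum_insert hi, Finset.prod_insert hi, sgn2_add, ih]

lemma zLabel_mul_pauliOp {n : ℕ} (z : Fin n → ZMod 2) (f : Fin n → Fin 4) :
    pauliOp (zLabel z) * pauliOp f =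
      sgn2 (∑ i, xPart f i * z i) • (pauliOp f * pauliOp (zLabel z)) := by
  have h (i : Fin n) : pauli1 (zLabel z i) * pauli1 (f i) =
      sgn2 (xPart f i * z i) • (pauli1 (f i) * pauli1 (zLabel z i)) := by
    unfold zLabel xPart
    by_cases hz : z i = 0
    · simp [hz, sgn2, pauli1]
    · generalize f i = k
      fin_cases k <;> simp [hz, sgn2, pauli1]
  simp only [pauliOp_eq_tensorOp, tensorOp_mul, h, tensorOp_smul, sgn2_sum]

lemma exists_eq_zLabel {n : ℕ} {f : Fin n → Fin 4} (hf : xPart f = 0) :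
    ∃ z, f = zLabel z := by
  refine ⟨fun i => if f i = 0 then 0 else 1, funext fun i => ?_⟩
  have h (k : Fin 4) (hk : ¬(k = 1 ∨ k = 2)) : k = 0 ∨ k = 3 := by revert k; decide
  rcases h (f i) (by simpa [xPart] using congrFun hf i) with h | h <;> simp [zLabel, h]

lemma Kop_isHermitian {n : ℕ} (G : SimpleGraph (Fin n)) [DecidableRel G.Adj] (a : Fin n) :
    (Kop G a).IsHermitian :=
  pauliOp_isHermitian _

/-- If `A ψ = ψ` for a Hermitian `A` anticommuting with `B`, then `⟨ψ|B|ψ⟩ = 0`. -/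
lemma expectation_eq_zero_of_anticommute {m : Type*} [Fintype m] {A B : Matrix m m ℂ}
    (hA : A.IsHermitian) {ψ : m → ℂ} (hψ : A *ᵥ ψ = ψ) (hAB : B * A = -(A * B)) :
    star ψ ⬝ᵥ B *ᵥ ψ = 0 := by
  have h : star ψ ⬝ᵥ B *ᵥ ψ = -(star ψ ⬝ᵥ B *ᵥ ψ) := by
    calc star ψ ⬝ᵥ B *ᵥ ψ = star ψ ⬝ᵥ (B * A) *ᵥ ψ := by rw [← Matrix.mulVec_mulVec, hψ]
      _ = -(star ψ ⬝ᵥ A *ᵥ B *ᵥ ψ) := by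
        rw [hAB, Matrix.neg_mulVec, dotProduct_neg, Matrix.mulVec_mulVec]
      _ = -(star (A *ᵥ ψ) ⬝ᵥ B *ᵥ ψ) := by
        rw [Matrix.dotProduct_mulVec, Matrix.star_mulVec, hA.eq]
      _ = _ := by rw [hψ]
  exact self_eq_neg.mp h

/-- The bit-flip parts of the Pauli operators occurring, up to a scalar, in a submonoid. -/
def xPartSubmodule {n : ℕ} (T : Submonoid (QOp n)) : Submodule (ZMod 2) (Fin n → ZMod 2) where
  carrier := {x | ∃ f, ∃ c : ℂ, c ≠ 0 ∧ c • pauliOp f ∈ T ∧ xPart f = x}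
  zero_mem' := ⟨0, 1, one_ne_zero, by simp [pauliOp_zero], by ext; simp [xPart]⟩
  add_mem' := by
    rintro _ _ ⟨f, c, hc, hf, rfl⟩ ⟨g, e, he, hg, rfl⟩
    obtain ⟨k, hk, hfg⟩ := exists_pauliOp_mul f g
    refine ⟨_, c * e * k, by simp [hc, he, hk], ?_, xPart_xor f g⟩
    have := T.mul_mem hf hg
    rwa [smul_mul_smul_comm, hfg, smul_smul] at this
  smul_mem' := by
    rintro a _ ⟨f, c, hc, hf, rfl⟩
    have ha : a = 0 ∨ a = 1 := by revert a; decide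
    rcases ha with rfl | rfl
    · exact ⟨0, 1, one_ne_zero, by simp [pauliOp_zero], by ext; simp [xPart]⟩
    · exact ⟨f, c, hc, hf, by simp⟩

/-- The operators fixing a given vector. -/
def fixSubmonoid {n : ℕ} (ψ : QState n) : Submonoid (QOp n) where
  carrier := {A | A *ᵥ ψ = ψ}
  one_mem' := Matrix.one_mulVec ψ
  mul_mem' := by
    intro A B hA hB
    change (A * B) *ᵥ ψ = ψ
    rw [← Matrix.mulVec_mulVec, show B *ᵥ ψ = ψ from hB, show A *ᵥ ψ = ψ from hA]

lemma IsGraphState.ne_zero {n : ℕ} {G : SimpleGraph (Fin n)} [DecidableRel G.Adj] {ψ : QState n}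
    (hψ : IsGraphState G ψ) : ψ ≠ 0 := by
  rintro rfl
  simpa [qNormSq] using hψ.1

lemma xPart_Kop_label {n : ℕ} (G : SimpleGraph (Fin n)) [DecidableRel G.Adj] (a : Fin n) :
    xPart (fun b => if b = a then 1 else if G.Adj a b then 3 else 0) = Pi.single a 1 := by
  ext b
  by_cases hb : b = a
  · subst hb; simp [xPart]
  · by_cases h : G.Adj a b <;> simp [xPart, hb, h]

lemma IsGraphState.xPartSubmodule_fix {n : ℕ} {G : SimpleGraph (Fin n)} [DecidableRel G.Adj]
    {ψ : QState n} (hψ : IsGraphState G ψ) : xPartSubmodule (fixSubmonoid ψ) = ⊤ := by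
  refine Submodule.eq_top_iff'.mpr fun x => ?_
  have hx : x = ∑ a, x a • (Pi.single a 1 : Fin n → ZMod 2) := by
    ext i; simp [Finset.sum_apply, Pi.single_apply]
  rw [hx]
  refine Submodule.sum_mem _ fun a _ => Submodule.smul_mem _ _
    ⟨_, 1, one_ne_zero, ?_, xPart_Kop_label G a⟩
  rw [one_smul]
  exact hψ.2 a

lemma IsGraphState.expectation_of_xPart_eq_zero {n : ℕ} {G : SimpleGraph (Fin n)}
    [DecidableRel G.Adj] {ψ : QState n} (hψ : IsGraphState G ψ) {f : Fin n → Fin 4}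
    (hf : xPart f = 0) (hf0 : f ≠ 0) : star ψ ⬝ᵥ pauliOp f *ᵥ ψ = 0 := by
  obtain ⟨z, rfl⟩ := exists_eq_zLabel hf
  obtain ⟨a, ha⟩ := Function.ne_iff.mp hf0
  have hza : z a ≠ 0 := fun h => ha (by simp [zLabel, h])
  refine expectation_eq_zero_of_anticommute (Kop_isHermitian G a) (hψ.2 a) ?_
  rw [Kop, zLabel_mul_pauliOp, xPart_Kop_label]
  simp [Pi.single_apply, sgn2, hza]

/-- A Pauli operator with nonzero expectation in a graph state is, up to sign, a stabilizer. -/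
lemma IsGraphState.exists_sign_of_expectation_ne_zero {n : ℕ} {G : SimpleGraph (Fin n)}
    [DecidableRel G.Adj] {ψ : QState n} (hψ : IsGraphState G ψ) {f : Fin n → Fin 4}
    (hf : star ψ ⬝ᵥ pauliOp f *ᵥ ψ ≠ 0) :
    pauliOp f *ᵥ ψ = ψ ∨ (-pauliOp f) *ᵥ ψ = ψ := by
  obtain ⟨g, c, hc, hg, hgf⟩ : xPart f ∈ xPartSubmodule (fixSubmonoid ψ) :=
    hψ.xPartSubmodule_fix ▸ Submodule.mem_top
  change (c • pauliOp g) *ᵥ ψ = ψ at hg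
  obtain ⟨k, hk, hfg⟩ := exists_pauliOp_mul f g
  have hx : xPart (fun i => f i ^^^ g i) = 0 := by
    rw [xPart_xor, hgf]
    ext i; exact CharTwo.add_self_eq_zero _
  have hmul : pauliOp f *ᵥ ψ = (c * k) • pauliOp (fun i => f i ^^^ g i) *ᵥ ψ := by
    conv_lhs => rw [← hg]
    rw [Matrix.mulVec_mulVec, mul_smul_comm, hfg, smul_smul, Matrix.smul_mulVec]
  have h0 : (fun i => f i ^^^ g i) = 0 := by
    by_contra h0
    exact hf (by rw [hmul, dotProduct_smul, hψ.expectation_of_xPart_eq_zero hx h0, smul_zero])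
  rw [h0, pauliOp_zero, Matrix.one_mulVec] at hmul
  have hsq : ((c * k) * (c * k)) • ψ = (1 : ℂ) • ψ := by
    rw [← smul_smul, ← hmul, ← Matrix.mulVec_smul, ← hmul, Matrix.mulVec_mulVec,
      pauliOp_mul_self, Matrix.one_mulVec, one_smul]
  rcases mul_self_eq_one_iff.mp (smul_left_injective ℂ hψ.ne_zero hsq) with h | h
  · left; rw [hmul, h, one_smul]
  · right; rw [Matrix.neg_mulVec, hmul, h, neg_one_smul, neg_neg]

lemma closure_stabW_le_fix {n : ℕ} (ψ : QState n) (d : ℕ) :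
    Submonoid.closure (stabW ψ d) ≤ fixSubmonoid ψ :=
  Submonoid.closure_le.mpr fun _ hg => hg.1.2

open scoped ComplexOrder in
/-- A stabilizer element whose bit-flip part is realized in `S_d` belongs to `S_d`. -/
lemma IsGraphState.mem_SdSet {n : ℕ} {G : SimpleGraph (Fin n)} [DecidableRel G.Adj]
    {ψ : QState n} (hψ : IsGraphState G ψ) {d : ℕ} {g : QOp n} {f : Fin n → Fin 4}
    (hgf : IsSignedPauli g f) (hg : g *ᵥ ψ = ψ)
    (hf : xPart f ∈ xPartSubmodule (Submonoid.closure (stabW ψ d))) : g ∈ SdSet ψ d := by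
  obtain ⟨f', c, hc, hm, hx'⟩ := hf
  have hmψ : (c • pauliOp f') *ᵥ ψ = ψ := closure_stabW_le_fix ψ d hm
  obtain ⟨s, hs, rfl⟩ : ∃ s : ℂ, s * s = 1 ∧ g = s • pauliOp f := by
    rcases hgf with rfl | rfl
    · exact ⟨1, by simp, by simp⟩
    · exact ⟨-1, by simp, by simp⟩
  obtain ⟨k, hk, hff⟩ := exists_pauliOp_mul f f'
  have hmul : (s • pauliOp f) * (c • pauliOp f') =
      (s * c * k) • pauliOp fun i => f i ^^^ f' i := by
    rw [smul_mul_smul_comm, hff, smul_smul]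
  have hfix : (s * c * k) • pauliOp (fun i => f i ^^^ f' i) *ᵥ ψ = ψ := by
    rw [← Matrix.smul_mulVec, ← hmul, ← Matrix.mulVec_mulVec, hmψ, hg]
  have hx : xPart (fun i => f i ^^^ f' i) = 0 := by
    rw [xPart_xor, hx']
    ext i; exact CharTwo.add_self_eq_zero _
  have h0 : (fun i => f i ^^^ f' i) = 0 := by
    by_contra h0
    have h := congrArg (star ψ ⬝ᵥ ·) hfix
    simp only [dotProduct_smul, hψ.expectation_of_xPart_eq_zero hx h0, smul_zero] at h
    exact hψ.ne_zero (dotProduct_star_self_eq_zero.mp h.symm)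
  rw [h0, pauliOp_zero, Matrix.one_mulVec] at hfix
  have hone : s * c * k = 1 :=
    smul_left_injective ℂ hψ.ne_zero (hfix.trans (one_smul ℂ ψ).symm)
  rw [h0, pauliOp_zero, hone, one_smul] at hmul
  have heq : c • pauliOp f' = s • pauliOp f := by
    calc c • pauliOp f' = ((s • pauliOp f) * (s • pauliOp f)) * (c • pauliOp f') := by
          rw [smul_mul_smul_comm, pauliOp_mul_self, hs, one_smul, one_mul]
      _ = s • pauliOp f := by rw [mul_assoc, hmul, mul_one]
  exact heq ▸ hm

open scoped ComplexOrder in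
/-- If a Hermitian matrix has no real eigenvalue below `E`, then every vector attaining the
expectation value `E` is an eigenvector. -/
lemma mulVec_eq_of_expectation_eq_min {n : ℕ} {H : QOp n} (hH : H.IsHermitian) {E : ℝ}
    (hE : ∀ E' φ, IsEigenpair H E' φ → E ≤ E') {φ : QState n}
    (hφ : star φ ⬝ᵥ H *ᵥ φ = E * (star φ ⬝ᵥ φ)) : H *ᵥ φ = (E : ℂ) • φ := by
  have hA : (H - (E : ℂ) • (1 : QOp n)).IsHermitian := by
    refine hH.sub ?_
    simp [Matrix.IsHermitian, Matrix.conjTranspose_smul]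
  have hpos : (H - (E : ℂ) • (1 : QOp n)).PosSemidef := by
    rw [hA.posSemidef_iff_eigenvalues_nonneg]
    intro j
    have hj := hA.mulVec_eigenvectorBasis j
    have hne : (⇑(hA.eigenvectorBasis j) : QState n) ≠ 0 := fun h =>
      hA.eigenvectorBasis.toBasis.ne_zero j (by
        rw [OrthonormalBasis.coe_toBasis]; ext i; exact congrFun h i)
    have := hE (hA.eigenvalues j + E) _ ⟨hne, by
      rw [Matrix.sub_mulVec, Matrix.smul_mulVec, Matrix.one_mulVec, sub_eq_iff_eq_add] at hj
      rw [hj, Complex.ofReal_add, add_smul]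
      rfl⟩
    simpa using this
  have h0 := (hpos.dotProduct_mulVec_zero_iff φ).mp (by
    rw [Matrix.sub_mulVec, Matrix.smul_mulVec, Matrix.one_mulVec, dotProduct_sub, hφ,
      dotProduct_smul, smul_eq_mul, sub_self])
  rwa [Matrix.sub_mulVec, Matrix.smul_mulVec, Matrix.one_mulVec, sub_eq_zero] at h0

lemma IsDBody.isHermitian {n d : ℕ} {H : QOp n} (hH : IsDBody d H) : H.IsHermitian := by
  obtain ⟨h, -, rfl⟩ := hH
  simp [Matrix.IsHermitian, Matrix.conjTranspose_sum, Matrix.conjTranspose_smul,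
    (pauliOp_isHermitian _).eq]

open scoped ComplexOrder in
/-- Orthogonal nonzero eigenvectors force a multiplicity of at least two. -/
lemma two_le_eigDim {n : ℕ} {H : QOp n} {E : ℝ} {ψ φ : QState n} (hψ : IsEigenpair H E ψ)
    (hφ : IsEigenpair H E φ) (horth : star ψ ⬝ᵥ φ = 0) : 2 ≤ eigDim H E := by
  have hli : LinearIndependent ℂ ![ψ, φ] := by
    rw [LinearIndependent.pair_iff]
    intro s t hst
    have hs : s = 0 := by
      have h := congrArg (star ψ ⬝ᵥ ·) hst
      simpa [dotProduct_add, horth, dotProduct_star_self_eq_zero, hψ.1] using h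
    subst hs
    simpa [hφ.1] using hst
  let W := Module.End.eigenspace (Matrix.mulVecLin H) (E : ℂ)
  have hmem (i : Fin 2) : ![ψ, φ] i ∈ W := by
    rw [Module.End.mem_eigenspace_iff]
    fin_cases i
    · exact hψ.2
    · exact hφ.2
  have hli' : LinearIndependent ℂ fun i : Fin 2 => (⟨![ψ, φ] i, hmem i⟩ : W) :=
    LinearIndependent.of_comp W.subtype hli
  simpa [eigDim, W] using hli'.fintype_card_le_finrank

/-- for a connected graph `G` on `n ≥ 3` vertices with graph state `|G⟩`,
if `d < η(|G⟩)` and `H'` is a `d`-body Hamiltonian on `n` qubits having `|G⟩` as a ground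
state, then the ground state of `H'` is degenerate: the smallest eigenvalue has multiplicity
at least `2`.  Equivalently, any Hamiltonian having `|G⟩` as a non-degenerate ground state
must involve at least `η(|G⟩)`-body interactions. -/
theorem ground_state_degenerate_below_eta
    {n : ℕ} (hn : 3 ≤ n) (G : SimpleGraph (Fin n)) [DecidableRel G.Adj]
    (hG : G.Connected) (ψ : QState n) (hψ : IsGraphState G ψ)
    (d : ℕ) (hd : d < etaG ψ) (H' : QOp n) (hH' : IsDBody d H')
    (E : ℝ) (hgs : IsGroundStateE H' ψ E) :
    2 ≤ eigDim H' E := by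
  obtain ⟨g, ⟨⟨f₀, hgf⟩, hg⟩, hgS⟩ : ∃ g ∈ stab ψ, g ∉ SdSet ψ d :=
    Set.not_subset.mp (Nat.notMem_of_lt_sInf hd)
  obtain ⟨l, hl, hker⟩ := Submodule.exists_le_ker_of_notMem
    fun h => hgS (hψ.mem_SdSet hgf hg h)
  set z : Fin n → ZMod 2 := fun i => l fun j => if i = j then 1 else 0
  set P : QOp n := pauliOp (zLabel z) with hP
  have hcomm (f : Fin n → Fin 4) :
      P * pauliOp f = sgn2 (l (xPart f)) • (pauliOp f * P) := by
    rw [hP, zLabel_mul_pauliOp, l.pi_apply_eq_sum_univ (xPart f)]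
    rfl
  have hPP : P * P = 1 := pauliOp_mul_self _
  have hexp (A : QOp n) : star (P *ᵥ ψ) ⬝ᵥ A *ᵥ P *ᵥ ψ = star ψ ⬝ᵥ (P * A * P) *ᵥ ψ := by
    rw [Matrix.star_mulVec, (pauliOp_isHermitian _).eq, ← Matrix.dotProduct_mulVec,
      Matrix.mulVec_mulVec, Matrix.mulVec_mulVec]
  have hPne : P *ᵥ ψ ≠ 0 := fun h => hψ.ne_zero <| by
    rw [← Matrix.one_mulVec ψ, ← hPP, ← Matrix.mulVec_mulVec, h, Matrix.mulVec_zero]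
  have horth : star ψ ⬝ᵥ P *ᵥ ψ = 0 := by
    have hs : P * pauliOp f₀ = -(pauliOp f₀ * P) := by
      rw [hcomm, sgn2, if_neg hl, neg_one_smul]
    rcases hgf with rfl | rfl
    · exact expectation_eq_zero_of_anticommute (pauliOp_isHermitian f₀) hg hs
    · exact expectation_eq_zero_of_anticommute (pauliOp_isHermitian f₀).neg hg (by simp [hs])
  have hlow (f : Fin n → Fin 4) (hf : pWeight f ≤ d) :
      star ψ ⬝ᵥ (P * pauliOp f * P) *ᵥ ψ = star ψ ⬝ᵥ pauliOp f *ᵥ ψ := by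
    rw [hcomm, smul_mul_assoc, mul_assoc, hPP, mul_one, Matrix.smul_mulVec, dotProduct_smul]
    by_cases h0 : star ψ ⬝ᵥ pauliOp f *ᵥ ψ = 0
    · rw [h0, smul_zero]
    · have hmem : xPart f ∈ xPartSubmodule (Submonoid.closure (stabW ψ d)) := by
        rcases hψ.exists_sign_of_expectation_ne_zero h0 with h | h
        · exact ⟨f, 1, one_ne_zero, by
            rw [one_smul]
            exact Submonoid.subset_closure ⟨⟨⟨f, Or.inl rfl⟩, h⟩, f, Or.inl rfl, hf⟩, rfl⟩
        · exact ⟨f, -1, neg_ne_zero.mpr one_ne_zero, by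
            rw [neg_one_smul]
            exact Submonoid.subset_closure ⟨⟨⟨f, Or.inr rfl⟩, h⟩, f, Or.inr rfl, hf⟩, rfl⟩
      rw [show l (xPart f) = 0 from hker hmem, sgn2, if_pos rfl, one_smul]
  have hHexp : star ψ ⬝ᵥ (P * H' * P) *ᵥ ψ = star ψ ⬝ᵥ H' *ᵥ ψ := by
    obtain ⟨h, hh, rfl⟩ := hH'
    simp only [Finset.mul_sum, Finset.sum_mul, Matrix.sum_mulVec, dotProduct_sum,
      mul_smul_comm, smul_mul_assoc, Matrix.smul_mulVec, dotProduct_smul]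
    refine Finset.sum_congr rfl fun f _ => ?_
    rcases le_or_gt (pWeight f) d with hf | hf
    · rw [hlow f hf]
    · simp [hh f hf]
  have hnorm : star (P *ᵥ ψ) ⬝ᵥ P *ᵥ ψ = star ψ ⬝ᵥ ψ := by
    have := hexp 1
    rwa [Matrix.one_mulVec, mul_one, hPP, Matrix.one_mulVec] at this
  refine two_le_eigDim hgs.1 ⟨hPne, ?_⟩ horth
  refine mulVec_eq_of_expectation_eq_min hH'.isHermitian hgs.2 ?_
  rw [hexp, hHexp, hgs.1.2, dotProduct_smul, smul_eq_mul, hnorm]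
end
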